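/- arXiv:2406.05237 — 5 statements merged into one kernel-verified Lean document; each statement's English description precedes it below -/
import Mathlib

section
/- Let m > 1 be real and set p = 1/m. For every t > 0 and all real (x,y) with x^2 + y^2 < (4m/(p(m-1))) * t^{p}, the two-dimensional Barenblatt function B_m(x,y,t) = t^{-p} * (1 - (p(m-1)/(4m)) * (x^2 + y^2) / t^{p})^{1/(m-1)} satisfies the two-dimensional porous medium equation pointwise: ∂_t B_m = ∂_{xx}(B_m^m) + ∂_{yy}(B_m^m). -/
lemma aux_dd (A K d q x : ℝ) (F : ℝ → ℝ) (hx : 0 < 1 - K * (x ^ 2 + d))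
    (hF : ∀ a, 0 < 1 - K * (a ^ 2 + d) → F a = A * (1 - K * (a ^ 2 + d)) ^ (q + 1)) :
    deriv (deriv F) x = A * (q + 1) * (-2 * K) *
      ((1 - K * (x ^ 2 + d)) ^ q - 2 * K * q * x ^ 2 * (1 - K * (x ^ 2 + d)) ^ (q - 1)) := by
  have hw : ∀ a : ℝ, HasDerivAt (fun a : ℝ => 1 - K * (a ^ 2 + d)) (-2 * K * a) a := by
    intro a
    have := ((((hasDerivAt_id a).pow 2).add_const d).const_mul K).const_sub 1
    refine this.congr_deriv ?_
    simp; ring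
  have hopen : IsOpen {a : ℝ | 0 < 1 - K * (a ^ 2 + d)} :=
    isOpen_lt continuous_const (by fun_prop)
  have h1 : ∀ a : ℝ, 0 < 1 - K * (a ^ 2 + d) →
      deriv F a = A * (q + 1) * (-2 * K) * (a * (1 - K * (a ^ 2 + d)) ^ q) := by
    intro a ha
    have he : F =ᶠ[nhds a] fun a => A * (1 - K * (a ^ 2 + d)) ^ (q + 1) :=
      Filter.eventually_of_mem (hopen.mem_nhds ha) hF
    rw [he.deriv_eq]
    have := ((hw a).rpow_const (p := q + 1) (Or.inl ha.ne')).const_mul A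
    rw [this.deriv, add_sub_cancel_right]
    ring
  have he : deriv F =ᶠ[nhds x] fun a => A * (q + 1) * (-2 * K) * (a * (1 - K * (a ^ 2 + d)) ^ q) :=
    Filter.eventually_of_mem (hopen.mem_nhds hx) h1
  rw [he.deriv_eq]
  have := ((hasDerivAt_id x).mul ((hw x).rpow_const (p := q) (Or.inl hx.ne'))).const_mul
    (A * (q + 1) * (-2 * K))
  refine this.deriv.trans ?_
  simp only [id]
  ring

/-- The two-dimensional Barenblatt function satisfies the porous medium equation
`∂_t B = ∂_xx (B^m) + ∂_yy (B^m)` pointwise inside the wave front. -/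
theorem barenblatt_2d_solves_pme
    (m : ℝ) (hm : 1 < m) (p : ℝ) (hp : p = 1 / m)
    (B : ℝ → ℝ → ℝ → ℝ)
    (hB : ∀ x y t : ℝ, B x y t =
      t ^ (-p) * (1 - p * (m - 1) / (4 * m) * (x ^ 2 + y ^ 2) / t ^ p) ^ (1 / (m - 1)))
    (t x y : ℝ) (ht : 0 < t)
    (hxy : x ^ 2 + y ^ 2 < 4 * m / (p * (m - 1)) * t ^ p) :
    deriv (fun s : ℝ => B x y s) t =
      deriv (deriv (fun a : ℝ => B a y t ^ m)) x +
      deriv (deriv (fun b : ℝ => B x b t ^ m)) y := by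
  have hm0 : 0 < m := by linarith
  have hm1 : 0 < m - 1 := by linarith
  have hp0 : 0 < p := by rw [hp]; positivity
  have hT : 0 < t ^ p := Real.rpow_pos_of_pos ht p
  obtain ⟨c, hc⟩ : ∃ c, c = p * (m - 1) / (4 * m) := ⟨_, rfl⟩
  obtain ⟨q, hq⟩ : ∃ q, q = 1 / (m - 1) := ⟨_, rfl⟩
  have hc0 : 0 < c := by rw [hc]; positivity
  have hqm : q * m = q + 1 := by rw [hq]; field_simp; ring
  have hpm : -p * m = -1 := by rw [hp]; field_simp
  have hqc : (q + 1) * c = p / 4 := by rw [hq, hc]; field_simp; ring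
  simp only [← hc, ← hq] at hB
  obtain ⟨K, hK⟩ : ∃ K, K = c / t ^ p := ⟨_, rfl⟩
  have hw : 0 < 1 - K * (x ^ 2 + y ^ 2) := by
    have h2 : 4 * m / (p * (m - 1)) = 1 / c := by rw [hc]; field_simp
    rw [h2] at hxy
    have h3 : K * (x ^ 2 + y ^ 2) < K * (1 / c * t ^ p) :=
      mul_lt_mul_of_pos_left hxy (by rw [hK]; positivity)
    have h4 : K * (1 / c * t ^ p) = 1 := by rw [hK]; field_simp
    linarith
  have hBm : ∀ a b, 0 < 1 - K * (a ^ 2 + b ^ 2) →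
      B a b t ^ m = t⁻¹ * (1 - K * (a ^ 2 + b ^ 2)) ^ (q + 1) := by
    intro a b h
    have e : 1 - c * (a ^ 2 + b ^ 2) / t ^ p = 1 - K * (a ^ 2 + b ^ 2) := by rw [hK]; ring
    rw [hB, e, Real.mul_rpow (by positivity) (by positivity), ← Real.rpow_mul ht.le,
      ← Real.rpow_mul h.le, hqm, hpm, Real.rpow_neg_one]
  rw [aux_dd t⁻¹ K (y ^ 2) q x _ hw (fun a ha => hBm a y ha),
    aux_dd t⁻¹ K (x ^ 2) q y _ (by rwa [add_comm]) (fun b hb => by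
      rw [add_comm] at hb; rw [hBm x b hb, add_comm (b ^ 2)]), add_comm (y ^ 2) (x ^ 2)]
  -- time derivative
  have hfun : (fun s : ℝ => B x y s) =ᶠ[nhds t]
      fun s => s ^ (-p) * (1 - c * (x ^ 2 + y ^ 2) * s ^ (-p)) ^ q := by
    filter_upwards [lt_mem_nhds ht] with s hs
    rw [hB, div_eq_mul_inv, Real.rpow_neg hs.le]
  rw [hfun.deriv_eq]
  have hs := Real.hasDerivAt_rpow_const (x := t) (p := -p) (Or.inl ht.ne')
  have e : 1 - c * (x ^ 2 + y ^ 2) * t ^ (-p) = 1 - K * (x ^ 2 + y ^ 2) := by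
    rw [hK, Real.rpow_neg ht.le]; ring
  have hd := hs.mul (((hs.const_mul (c * (x ^ 2 + y ^ 2))).const_sub 1).rpow_const (p := q)
    (Or.inl (by rw [e]; exact hw.ne')))
  refine hd.deriv.trans ?_
  rw [e, Real.rpow_sub_one ht.ne', Real.rpow_neg ht.le]
  have hK' : K = c * (t ^ p)⁻¹ := by rw [hK]; rfl
  generalize (1 - K * (x ^ 2 + y ^ 2)) ^ q = W
  generalize (1 - K * (x ^ 2 + y ^ 2)) ^ (q - 1) = V
  rw [hK', div_eq_mul_inv]
  generalize (t ^ p)⁻¹ = S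
  have hpq : p = 4 * ((q + 1) * c) := by linarith
  rw [hpq]
  ring
end

section
/- Let A be a real N×N matrix, let v_0, v_1, …, v_p ∈ ℝ^N, and let y : ℝ → ℝ^N be the differentiable function satisfying y(0) = v_0 and y'(t) = A y(t) + v_1 + t v_2 + ⋯ + (t^{p-1}/(p-1)!) v_p for all t. Then y(1) = φ_0(A) v_0 + φ_1(A) v_1 + ⋯ + φ_p(A) v_p, where for a square matrix A, φ_k(A) = Σ_{j=0}^∞ A^j / (j+k)!. -/
noncomputable def psiAux {𝔸 : Type*} [NormedRing 𝔸] [NormedAlgebra ℝ 𝔸] (A : 𝔸) (k : ℕ) (t : ℝ) : 𝔸 :=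
  ∑' j : ℕ, (t ^ (j + k) * ((j + k).factorial : ℝ)⁻¹) • A ^ j

theorem psi_bound {𝔸 : Type*} [NormedRing 𝔸] [NormedAlgebra ℝ 𝔸] (A : 𝔸) (k : ℕ)
    (R : ℝ) (hR : 0 ≤ R) :
    Summable fun j : ℕ => R ^ (j + k) * ((j + k).factorial : ℝ)⁻¹ * ‖A ^ j‖ := by
  have h := (NormedSpace.norm_expSeries_summable' (𝕂 := ℝ) (R • A)).mul_left (R ^ k)
  refine Summable.of_nonneg_of_le (fun j => by positivity) (fun j => ?_) h
  rw [smul_pow, norm_smul, norm_smul, Real.norm_of_nonneg (by positivity),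
    Real.norm_of_nonneg (by positivity)]
  have h1 : ((j + k).factorial : ℝ)⁻¹ ≤ (j.factorial : ℝ)⁻¹ := by
    apply inv_anti₀ (by positivity)
    exact_mod_cast Nat.factorial_le (by omega)
  calc _ ≤ R ^ (j + k) * (j.factorial : ℝ)⁻¹ * ‖A ^ j‖ := by gcongr
    _ = _ := by rw [pow_add]; ring

theorem psi_le {𝔸 : Type*} [NormedRing 𝔸] [NormedAlgebra ℝ 𝔸] (A : 𝔸) (k : ℕ)
    (R t : ℝ) (ht : |t| ≤ R) (j : ℕ) :
    ‖(t ^ (j + k) * ((j + k).factorial : ℝ)⁻¹) • A ^ j‖ ≤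
      R ^ (j + k) * ((j + k).factorial : ℝ)⁻¹ * ‖A ^ j‖ := by
  rw [norm_smul, norm_mul, norm_pow, Real.norm_eq_abs,
    Real.norm_of_nonneg (r := ((j + k).factorial : ℝ)⁻¹) (by positivity)]
  gcongr

theorem psi_summable {𝔸 : Type*} [NormedRing 𝔸] [NormedAlgebra ℝ 𝔸] [CompleteSpace 𝔸] (A : 𝔸)
    (k : ℕ) (t : ℝ) :
    Summable fun j : ℕ => (t ^ (j + k) * ((j + k).factorial : ℝ)⁻¹) • A ^ j :=
  Summable.of_norm_bounded (psi_bound A k |t| (abs_nonneg t)) (psi_le A k |t| t le_rfl)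

theorem psi_rec {𝔸 : Type*} [NormedRing 𝔸] [NormedAlgebra ℝ 𝔸] [CompleteSpace 𝔸] (A : 𝔸)
    (k : ℕ) (t : ℝ) :
    psiAux A k t = (t ^ k / (k.factorial : ℝ)) • (1 : 𝔸) + A * psiAux A (k + 1) t := by
  unfold psiAux
  rw [(psi_summable A k t).tsum_eq_zero_add, ← (psi_summable A (k + 1) t).tsum_mul_left]
  congr 1
  · simp [div_eq_mul_inv]
  · refine tsum_congr fun j => ?_
    rw [mul_smul_comm, ← pow_succ', show j + 1 + k = j + (k + 1) by ring]

theorem psi_deriv {𝔸 : Type*} [NormedRing 𝔸] [NormedAlgebra ℝ 𝔸] [CompleteSpace 𝔸] (A : 𝔸)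
    (k : ℕ) (t : ℝ) :
    HasDerivAt (psiAux A (k + 1)) (psiAux A k t) t := by
  have hR : 0 ≤ |t| + 1 := by positivity
  have hd : ∀ (j : ℕ) (x : ℝ), HasDerivAt
      (fun s : ℝ => (s ^ (j + (k + 1)) * ((j + (k + 1)).factorial : ℝ)⁻¹) • A ^ j)
      ((x ^ (j + k) * ((j + k).factorial : ℝ)⁻¹) • A ^ j) x := by
    intro j x
    have h := ((hasDerivAt_pow (j + (k + 1)) x).mul_const
      (((j + (k + 1)).factorial : ℝ)⁻¹)).smul_const (A ^ j)
    have e : ((j + (k + 1) : ℕ) : ℝ) * x ^ (j + (k + 1) - 1) *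
        (((j + (k + 1)).factorial : ℝ)⁻¹) = x ^ (j + k) * ((j + k).factorial : ℝ)⁻¹ := by
      rw [← add_assoc, Nat.factorial_succ, Nat.add_sub_cancel]
      have h1 : ((j + k).factorial : ℝ) ≠ 0 := by positivity
      have h2 : ((j + k + 1 : ℕ) : ℝ) ≠ 0 := by positivity
      rw [Nat.cast_mul, mul_inv]
      field_simp
    rw [e] at h
    exact h
  have hmem : t ∈ Metric.ball (0 : ℝ) (|t| + 1) := by
    rw [Metric.mem_ball, Real.dist_eq, sub_zero]; linarith
  exact hasDerivAt_tsum_of_isPreconnected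
    (g := fun (j : ℕ) (s : ℝ) => (s ^ (j + (k + 1)) * ((j + (k + 1)).factorial : ℝ)⁻¹) • A ^ j)
    (g' := fun (j : ℕ) (x : ℝ) => (x ^ (j + k) * ((j + k).factorial : ℝ)⁻¹) • A ^ j)
    (psi_bound A k (|t| + 1) hR)
    (t := Metric.ball (0 : ℝ) (|t| + 1)) Metric.isOpen_ball
    (convex_ball _ _).isPreconnected (fun j x _ => hd j x)
    (fun j x hx => psi_le A k _ x (by
      rw [Metric.mem_ball, Real.dist_eq, sub_zero] at hx; exact hx.le) j)
    (y₀ := t) hmem (psi_summable A (k + 1) t) hmem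

theorem psi_deriv_zero {𝔸 : Type*} [NormedRing 𝔸] [NormedAlgebra ℝ 𝔸] [CompleteSpace 𝔸] (A : 𝔸)
    (t : ℝ) : HasDerivAt (psiAux A 0) (A * psiAux A 0 t) t := by
  have h : psiAux A 0 = fun t => (1 : 𝔸) + A * psiAux A 1 t := by
    funext s; rw [psi_rec]; simp
  have h2 := ((psi_deriv A 0 t).const_mul A).const_add (1 : 𝔸)
  rw [← h] at h2
  exact h2

theorem psi_at_zero {𝔸 : Type*} [NormedRing 𝔸] [NormedAlgebra ℝ 𝔸] (A : 𝔸)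
    (k : ℕ) : psiAux A (k + 1) 0 = 0 := by
  simp [psiAux, ← add_assoc]

theorem psi_zero_zero {𝔸 : Type*} [NormedRing 𝔸] [NormedAlgebra ℝ 𝔸] [CompleteSpace 𝔸] (A : 𝔸) :
    psiAux A 0 0 = 1 := by
  rw [psi_rec, psi_at_zero]; simp

attribute [local instance] Matrix.linftyOpNormedRing Matrix.linftyOpNormedAlgebra in
theorem psi_matrix (N : ℕ) (A : Matrix (Fin N) (Fin N) ℝ) :
    ∃ P : ℕ → ℝ → Matrix (Fin N) (Fin N) ℝ,
      (∀ k, P k 1 = ∑' j : ℕ, (((j + k).factorial : ℝ))⁻¹ • A ^ j) ∧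
      P 0 0 = 1 ∧ (∀ k, P (k + 1) 0 = 0) ∧
      (∀ w t, HasDerivAt (fun s => (P 0 s).mulVec w) (A.mulVec ((P 0 t).mulVec w)) t) ∧
      (∀ k w t, HasDerivAt (fun s => (P (k + 1) s).mulVec w)
        (A.mulVec ((P (k + 1) t).mulVec w) + (t ^ k / (k.factorial : ℝ)) • w) t) := by
  have key : ∀ (f : ℝ → Matrix (Fin N) (Fin N) ℝ) f' t (w : Fin N → ℝ), HasDerivAt f f' t →
      HasDerivAt (fun s => (f s).mulVec w) (f'.mulVec w) t := by
    intro f f' t w h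
    let L : Matrix (Fin N) (Fin N) ℝ →ₗ[ℝ] (Fin N → ℝ) :=
      { toFun := fun M => M.mulVec w
        map_add' := fun M M' => Matrix.add_mulVec M M' w
        map_smul' := fun c M => Matrix.smul_mulVec c M w }
    exact (LinearMap.toContinuousLinearMap L).hasFDerivAt.comp_hasDerivAt t h
  refine ⟨psiAux A, fun k => ?_, psi_zero_zero A, psi_at_zero A, fun w t => ?_, fun k w t => ?_⟩
  · simp [psiAux]; rfl
  · rw [Matrix.mulVec_mulVec]
    exact key _ _ t w (psi_deriv_zero A t)
  · have h := key _ _ t w (psi_deriv A k t)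
    rw [psi_rec, Matrix.add_mulVec, Matrix.smul_mulVec, Matrix.one_mulVec,
      ← Matrix.mulVec_mulVec, add_comm (_ • w)] at h
    exact h

/-- The linear combination of φ-functions `φ₀(A)v₀ + φ₁(A)v₁ + ⋯ + φ_p(A)v_p` equals the
value at `t = 1` of the solution of `y' = A y + v₁ + t v₂ + ⋯ + t^{p-1}/(p-1)! v_p`,
`y(0) = v₀`, where `φ_k(A) = Σ_{j≥0} A^j/(j+k)!`. -/
theorem phi_combination_is_ode_solution
    (N p : ℕ) (A : Matrix (Fin N) (Fin N) ℝ) (v : ℕ → Fin N → ℝ)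
    (y : ℝ → Fin N → ℝ) (hy0 : y 0 = v 0)
    (hy : ∀ t : ℝ, HasDerivAt y
      (A.mulVec (y t) +
        ∑ k ∈ Finset.Icc 1 p, (t ^ (k - 1) / ((k - 1).factorial : ℝ)) • v k) t)
    (φ : ℕ → Matrix (Fin N) (Fin N) ℝ → Matrix (Fin N) (Fin N) ℝ)
    (hφ : ∀ (k : ℕ) (B : Matrix (Fin N) (Fin N) ℝ),
      φ k B = ∑' j : ℕ, (((j + k).factorial : ℝ))⁻¹ • B ^ j) :
    y 1 = ∑ k ∈ Finset.range (p + 1), (φ k A).mulVec (v k) := by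
  obtain ⟨P, hP1, hP00, hPk0, hd0, hdk⟩ := psi_matrix N A
  have hI : ∀ (F : ℕ → Fin N → ℝ), ∑ k ∈ Finset.Icc 1 p, F k = ∑ k ∈ Finset.range p, F (k + 1) := by
    intro F
    rw [Finset.range_eq_Ico, Finset.sum_Ico_add' F 0 p 1]
    rfl
  let L := LinearMap.toContinuousLinearMap (Matrix.toLin' A)
  have hL : ∀ x, L x = A.mulVec x := fun x => by simp [L]
  have huniq : y = fun t => ∑ k ∈ Finset.range (p + 1), (P k t).mulVec (v k) := by
    refine ODE_solution_unique_univ (K := ‖L‖₊) (s := fun _ => Set.univ) (t₀ := 0)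
      (v := fun t x => A.mulVec x +
        ∑ k ∈ Finset.Icc 1 p, (t ^ (k - 1) / ((k - 1).factorial : ℝ)) • v k)
      (fun t => ?_) (fun t => ⟨hy t, trivial⟩) (fun t => ⟨?_, trivial⟩) ?_
    · refine LipschitzWith.lipschitzOnWith (LipschitzWith.of_dist_le_mul fun a b => ?_)
      rw [dist_add_right, ← hL, ← hL]
      exact L.lipschitz.dist_le_mul a b
    · simp only [Finset.sum_range_succ', hI, Nat.add_sub_cancel]
      have h := (HasDerivAt.fun_sum (u := Finset.range p)
        (fun k _ => hdk k (v (k + 1)) t)).fun_add (hd0 (v 0) t)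
      convert h using 1
      rw [Finset.sum_add_distrib, Matrix.mulVec_add, Matrix.mulVec_sum]
      abel
    · simp [Finset.sum_range_succ', hPk0, hP00, hy0]
  rw [huniq]
  simp only [hP1, hφ]
end

section
/- Let V be a real N×m matrix with orthonormal columns (Vᵀ V = I_m), let H be a real m×m matrix, and let v ∈ ℝ^N lie in the column space of V. Then for every natural number k, φ_k(V H Vᵀ) v = V φ_k(H) Vᵀ v, where for a square matrix A, φ_k(A) = Σ_{j=0}^∞ A^j / (j+k)!. In particular, if v = ‖v‖ · (first column of V), then φ_k(V H Vᵀ) v = ‖v‖ · V φ_k(H) e_1, where e_1 is the first standard basis vector of ℝ^m. -/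
open Matrix

section aux
attribute [local instance] Matrix.linftyOpNormedRing Matrix.linftyOpNormedAlgebra

theorem phi_summable_aux (n k : ℕ) (B : Matrix (Fin n) (Fin n) ℝ) :
    Summable (fun j : ℕ => (((j + k).factorial : ℝ))⁻¹ • B ^ j) := by
  refine Summable.of_norm_bounded (NormedSpace.norm_expSeries_summable' (𝕂 := ℝ) B) ?_
  intro j
  rw [norm_smul, norm_smul]
  refine mul_le_mul_of_nonneg_right ?_ (norm_nonneg _)
  rw [norm_inv, norm_inv, Real.norm_natCast, Real.norm_natCast]
  have h1 : (0 : ℝ) < (j.factorial : ℝ) := by exact_mod_cast j.factorial_pos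
  have h2 : (j.factorial : ℝ) ≤ ((j + k).factorial : ℝ) := by
    exact_mod_cast Nat.factorial_le (Nat.le_add_right j k)
  exact inv_anti₀ h1 h2

end aux

theorem phi_intertwine_aux (N m : ℕ)
    (V : Matrix (Fin N) (Fin m) ℝ) (H : Matrix (Fin m) (Fin m) ℝ)
    (hV : Vᵀ * V = 1) (k : ℕ) :
    (∑' j : ℕ, (((j + k).factorial : ℝ))⁻¹ • (V * H * Vᵀ) ^ j) * V =
      V * (∑' j : ℕ, (((j + k).factorial : ℝ))⁻¹ • H ^ j) := by
  have hp : ∀ j : ℕ, (V * H * Vᵀ) ^ j * V = V * H ^ j := by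
    intro j
    induction j with
    | zero => simp
    | succ j ih =>
      rw [pow_succ, Matrix.mul_assoc, Matrix.mul_assoc (V * H), hV, Matrix.mul_one,
        ← Matrix.mul_assoc, ih, Matrix.mul_assoc, ← pow_succ]
  have h1 := (phi_summable_aux N k (V * H * Vᵀ)).hasSum.map
    (AddMonoidHom.mk' (fun X : Matrix (Fin N) (Fin N) ℝ => X * V)
      (fun a b => Matrix.add_mul a b V)) (continuous_id.matrix_mul continuous_const)
  have h2 := (phi_summable_aux m k H).hasSum.map
    (AddMonoidHom.mk' (fun X : Matrix (Fin m) (Fin m) ℝ => V * X)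
      (fun a b => Matrix.mul_add V a b)) (continuous_const.matrix_mul continuous_id)
  refine h1.unique ?_
  convert h2 using 1
  · funext j
    simp [hp]
  · rfl

/-- Krylov subspace projection identity for φ-functions: if `VᵀV = I` and `v` lies in the
column space of `V`, then `φ_k(V H Vᵀ) v = V φ_k(H) Vᵀ v`; in particular, if
`v = ‖v‖·(first column of V)` (Euclidean norm), then
`φ_k(V H Vᵀ) v = ‖v‖ V φ_k(H) e₁`. Here `φ_k(A) = Σ_{j≥0} A^j/(j+k)!`. -/
theorem krylov_projection_phi
    (N m : ℕ) (hm : 0 < m)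
    (V : Matrix (Fin N) (Fin m) ℝ) (H : Matrix (Fin m) (Fin m) ℝ)
    (hV : Vᵀ * V = 1)
    (v : Fin N → ℝ) (hv : ∃ c : Fin m → ℝ, v = V.mulVec c)
    (φ : ℕ → (n : ℕ) → Matrix (Fin n) (Fin n) ℝ → Matrix (Fin n) (Fin n) ℝ)
    (hφ : ∀ (k n : ℕ) (B : Matrix (Fin n) (Fin n) ℝ),
      φ k n B = ∑' j : ℕ, (((j + k).factorial : ℝ))⁻¹ • B ^ j)
    (k : ℕ) :
    (φ k N (V * H * Vᵀ)).mulVec v = V.mulVec ((φ k m H).mulVec (Vᵀ.mulVec v)) ∧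
    (v = Real.sqrt (∑ i, v i ^ 2) • (fun i => V i ⟨0, hm⟩) →
      (φ k N (V * H * Vᵀ)).mulVec v =
        Real.sqrt (∑ i, v i ^ 2) •
          V.mulVec ((φ k m H).mulVec (Pi.single ⟨0, hm⟩ 1))) := by
  have key : φ k N (V * H * Vᵀ) * V = V * φ k m H := by
    rw [hφ, hφ]
    exact phi_intertwine_aux N m V H hV k
  constructor
  · obtain ⟨c, rfl⟩ := hv
    rw [Matrix.mulVec_mulVec, key, Matrix.mulVec_mulVec c Vᵀ V, hV, Matrix.one_mulVec,
      Matrix.mulVec_mulVec]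
  · intro h
    have hc : (fun i => V i ⟨0, hm⟩) = V.mulVec (Pi.single ⟨0, hm⟩ 1) := by
      funext i
      simp
    rw [Matrix.mulVec_mulVec, ← key, ← Matrix.mulVec_mulVec, ← hc, ← Matrix.mulVec_smul, ← h]
end

section
/- For every real polynomial q of degree at most 6, every real x, and every real h ≠ 0, q'(x + h/2) = (1/(1920h)) * ( -9 q(x-2h) + 125 q(x-h) - 2250 q(x) + 2250 q(x+h) - 125 q(x+2h) + 9 q(x+3h) ). -/
/-- Exactness on polynomials of degree ≤ 6 of the sixth-order interface derivative formula. -/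
theorem interface_derivative_formula_order6
    (q : Polynomial ℝ) (hq : q.degree ≤ 6) (x h : ℝ) (hh : h ≠ 0) :
    (Polynomial.derivative q).eval (x + h / 2) =
      (1 / (1920 * h)) *
        (-9 * q.eval (x - 2 * h) + 125 * q.eval (x - h) - 2250 * q.eval x +
          2250 * q.eval (x + h) - 125 * q.eval (x + 2 * h) + 9 * q.eval (x + 3 * h)) := by
  have hn : q.natDegree < 7 :=
    Nat.lt_succ_of_le (Polynomial.natDegree_le_of_degree_le hq)
  rw [Polynomial.as_sum_range' q 7 hn]
  simp only [Finset.sum_range_succ, Finset.sum_range_zero, Polynomial.derivative_add,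
    Polynomial.derivative_monomial, Polynomial.eval_add, Polynomial.eval_monomial,
    Polynomial.derivative_zero, Polynomial.eval_zero]
  field_simp
  push_cast
  ring
end

section
/- For every real polynomial q of degree at most 8, every real x, and every real h ≠ 0, q'(x + h/2) = (1/(107520h)) * ( 75 q(x-3h) - 1029 q(x-2h) + 8575 q(x-h) - 128625 q(x) + 128625 q(x+h) - 8575 q(x+2h) + 1029 q(x+3h) - 75 q(x+4h) ). -/
/-- Exactness on polynomials of degree ≤ 8 of the eighth-order interface derivative formula. -/
theorem interface_derivative_formula_order8
    (q : Polynomial ℝ) (hq : q.degree ≤ 8) (x h : ℝ) (hh : h ≠ 0) :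
    (Polynomial.derivative q).eval (x + h / 2) =
      (1 / (107520 * h)) *
        (75 * q.eval (x - 3 * h) - 1029 * q.eval (x - 2 * h) + 8575 * q.eval (x - h) -
          128625 * q.eval x + 128625 * q.eval (x + h) - 8575 * q.eval (x + 2 * h) +
          1029 * q.eval (x + 3 * h) - 75 * q.eval (x + 4 * h)) := by
  have hn : q.natDegree < 9 := by
    have := Polynomial.natDegree_le_of_degree_le (n := 8) hq
    omega
  obtain ⟨y, rfl⟩ : ∃ y, x = y - h / 2 := ⟨x + h / 2, by ring⟩
  rw [q.as_sum_range' 9 hn]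
  simp only [Finset.sum_range_succ, Finset.sum_range_zero, Polynomial.derivative_add,
    Polynomial.derivative_zero, Polynomial.derivative_monomial, Polynomial.eval_add,
    Polynomial.eval_zero, Polynomial.eval_monomial]
  rw [one_div, eq_inv_mul_iff_mul_eq₀ (by positivity)]
  push_cast
  norm_num only
  ring
end
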